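/- arXiv:1711.00935 — 2 statements merged into one kernel-verified Lean document; each statement's English description precedes it below -/
import Mathlib

section
/- Let θ0, θ1, θ⋆ be real numbers with θ⋆0 = θ⋆ − θ0 ≠ 0 and θ⋆1 = θ⋆ − θ1 ≠ 0, let A be the associated biarc matrix, and suppose D := sinc θ⋆1 · cosc θ⋆0 − sinc θ⋆0 · cosc θ⋆1 ≠ 0. Then the pair s = (cos θ1 − cos θ⋆)/(θ⋆1 · D), t = (cos θ⋆ − cos θ0)/(θ⋆0 · D) is the unique solution of the linear system A·(s, t)ᵀ = (1, 0)ᵀ. -/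
noncomputable def sinc (x : ℝ) : ℝ := if x = 0 then 1 else Real.sin x / x
noncomputable def cosc (x : ℝ) : ℝ := if x = 0 then 0 else (1 - Real.cos x) / x

/-- The associated biarc matrix. -/
noncomputable def biarcA (θ0 θ1 θs : ℝ) : Matrix (Fin 2) (Fin 2) ℝ :=
  !![Real.cos θ0 * sinc (θs - θ0) - Real.sin θ0 * cosc (θs - θ0),
     Real.cos θ1 * sinc (θs - θ1) - Real.sin θ1 * cosc (θs - θ1);
     Real.sin θ0 * sinc (θs - θ0) + Real.cos θ0 * cosc (θs - θ0),
     Real.sin θ1 * sinc (θs - θ1) + Real.cos θ1 * cosc (θs - θ1)]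

/-- The top entry of a column of the biarc matrix is a difference quotient of `sin`. -/
lemma cos_mul_sinc_sub_sin_mul_cosc {x y : ℝ} (h : y - x ≠ 0) :
    Real.cos x * sinc (y - x) - Real.sin x * cosc (y - x) =
      (Real.sin y - Real.sin x) / (y - x) := by
  have hy : Real.sin y = Real.sin x * Real.cos (y - x) + Real.cos x * Real.sin (y - x) := by
    rw [← Real.sin_add, add_sub_cancel]
  rw [sinc, cosc, if_neg h, if_neg h, hy]
  ring

/-- The bottom entry of a column of the biarc matrix is a difference quotient of `-cos`. -/
lemma sin_mul_sinc_add_cos_mul_cosc {x y : ℝ} (h : y - x ≠ 0) :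
    Real.sin x * sinc (y - x) + Real.cos x * cosc (y - x) =
      (Real.cos x - Real.cos y) / (y - x) := by
  have hy : Real.cos y = Real.cos x * Real.cos (y - x) - Real.sin x * Real.sin (y - x) := by
    rw [← Real.cos_add, add_sub_cancel]
  rw [sinc, cosc, if_neg h, if_neg h, hy]
  ring

lemma biarcA_eq {θ0 θ1 θs : ℝ} (h0 : θs - θ0 ≠ 0) (h1 : θs - θ1 ≠ 0) :
    biarcA θ0 θ1 θs =
      !![(Real.sin θs - Real.sin θ0) / (θs - θ0), (Real.sin θs - Real.sin θ1) / (θs - θ1);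
         (Real.cos θ0 - Real.cos θs) / (θs - θ0), (Real.cos θ1 - Real.cos θs) / (θs - θ1)] := by
  rw [biarcA, cos_mul_sinc_sub_sin_mul_cosc h0, cos_mul_sinc_sub_sin_mul_cosc h1,
    sin_mul_sinc_add_cos_mul_cosc h0, sin_mul_sinc_add_cos_mul_cosc h1]

lemma det_biarcA {θ0 θ1 θs : ℝ} (h0 : θs - θ0 ≠ 0) (h1 : θs - θ1 ≠ 0) :
    (biarcA θ0 θ1 θs).det =
      sinc (θs - θ1) * cosc (θs - θ0) - sinc (θs - θ0) * cosc (θs - θ1) := by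
  rw [biarcA_eq h0 h1, Matrix.det_fin_two_of, sinc, sinc, cosc, cosc, if_neg h0, if_neg h1,
    if_neg h0, if_neg h1]
  field_simp
  rw [Real.sin_sub, Real.sin_sub, Real.cos_sub, Real.cos_sub]
  linear_combination (Real.sin θ1 * Real.cos θ0 - Real.sin θ0 * Real.cos θ1) * -
    Real.sin_sq_add_cos_sq θs

/-- Cramer's rule for a `2 × 2` system with right-hand side `(1, 0)`. -/
lemma mulVec_eq_one_zero_iff {K : Type*} [Field K] {a b c d : K}
    (h : !![a, b; c, d].det ≠ 0) (s t : K) :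
    !![a, b; c, d].mulVec ![s, t] = ![1, 0] ↔
      s = d / !![a, b; c, d].det ∧ t = -c / !![a, b; c, d].det := by
  rw [Matrix.det_fin_two_of] at h ⊢
  have hsys : !![a, b; c, d].mulVec ![s, t] = ![1, 0] ↔
      a * s + b * t = 1 ∧ c * s + d * t = 0 := by
    simp [funext_iff, Fin.forall_fin_two, mul_comm]
  rw [hsys, eq_div_iff h, eq_div_iff h]
  constructor
  · rintro ⟨e, f⟩
    constructor
    · linear_combination d * e - b * f
    · linear_combination a * f - c * e
  · rintro ⟨e, f⟩
    constructor <;> apply mul_right_cancel₀ h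
    · linear_combination a * e + b * f
    · linear_combination c * e + d * f

theorem biarc_cramer_solution (θ0 θ1 θs : ℝ)
    (h0 : θs - θ0 ≠ 0) (h1 : θs - θ1 ≠ 0)
    (D : ℝ)
    (hD : D = sinc (θs - θ1) * cosc (θs - θ0) - sinc (θs - θ0) * cosc (θs - θ1))
    (hDne : D ≠ 0) :
    (biarcA θ0 θ1 θs).mulVec
        ![(Real.cos θ1 - Real.cos θs) / ((θs - θ1) * D),
          (Real.cos θs - Real.cos θ0) / ((θs - θ0) * D)] = ![1, 0] ∧
    ∀ s t : ℝ, (biarcA θ0 θ1 θs).mulVec ![s, t] = ![1, 0] →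
      s = (Real.cos θ1 - Real.cos θs) / ((θs - θ1) * D) ∧
      t = (Real.cos θs - Real.cos θ0) / ((θs - θ0) * D) := by
  have hdet := det_biarcA h0 h1
  rw [← hD, biarcA_eq h0 h1] at hdet
  have key (s t : ℝ) := mulVec_eq_one_zero_iff (hdet ▸ hDne) s t
  simp only [hdet, div_div, ← neg_div, neg_sub] at key
  rw [biarcA_eq h0 h1]
  exact ⟨(key _ _).2 ⟨rfl, rfl⟩, fun s t => (key s t).1⟩
end

section
/- Let p0 = (x0, y0) and p1 = (x1, y1) be distinct points of ℝ², let d = ‖p1 − p0‖ > 0 and let α be a real number with x1 − x0 = d·cos α and y1 − y0 = d·sin α. Let ϑ0, ϑ1 be real angles with ϑ0 − α ∈ (−π, π), ϑ1 − α ∈ (−π, π) and ϑ0 ≠ ϑ1, and set ϑ⋆ = 2α − (ϑ0 + ϑ1)/2. Then there exist unique ℓ0 > 0, ℓ1 > 0 and κ0, κ1 ∈ ℝ such that: x0 + ℓ0·(cos ϑ0 · sinc(κ0ℓ0) − sin ϑ0 · cosc(κ0ℓ0)) = x1 − ℓ1·(cos ϑ1 · sinc(−κ1ℓ1) − sin ϑ1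 · cosc(−κ1ℓ1)); y0 + ℓ0·(sin ϑ0 · sinc(κ0ℓ0) + cos ϑ0 · cosc(κ0ℓ0)) = y1 − ℓ1·(sin ϑ1 · sinc(−κ1ℓ1) + cos ϑ1 · cosc(−κ1ℓ1)); ϑ0 + ℓ0κ0 = ϑ⋆; and ϑ1 − ℓ1κ1 = ϑ⋆. That is, the G¹ biarc interpolation problem with the Matlab joint-angle condition has a unique solution consisting of two (possibly degenerate) circular arcs of positive lengths ℓ0 and ℓ1 and constant curvatures κ0 and κ1. -/
theorem sinc_eq_sinc_half_mul_cos (u : ℝ) : sinc u = sinc (u / 2) * Real.cos (u / 2) := by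
  rcases eq_or_ne u 0 with rfl | hu
  · simp [sinc]
  · have h : Real.sin u = 2 * Real.sin (u / 2) * Real.cos (u / 2) := by
      rw [← Real.sin_two_mul]; ring_nf
    have hu2 : u / 2 ≠ 0 := by positivity
    simp only [sinc, if_neg hu, if_neg hu2, h]
    field_simp

theorem cosc_eq_sinc_half_mul_sin (u : ℝ) : cosc u = sinc (u / 2) * Real.sin (u / 2) := by
  rcases eq_or_ne u 0 with rfl | hu
  · simp [sinc, cosc]
  · have h : Real.cos u = 1 - 2 * Real.sin (u / 2) ^ 2 := by
      rw [← Real.cos_two_mul_eq_one_sub]; ring_nf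
    have hu2 : u / 2 ≠ 0 := by positivity
    simp only [sinc, cosc, if_neg hu, if_neg hu2, h]
    field_simp
    ring

theorem arc_chord_fst (ϑ u : ℝ) :
    Real.cos ϑ * sinc u - Real.sin ϑ * cosc u = sinc (u / 2) * Real.cos (ϑ + u / 2) := by
  rw [sinc_eq_sinc_half_mul_cos, cosc_eq_sinc_half_mul_sin, Real.cos_add]
  ring

theorem arc_chord_snd (ϑ u : ℝ) :
    Real.sin ϑ * sinc u + Real.cos ϑ * cosc u = sinc (u / 2) * Real.sin (ϑ + u / 2) := by
  rw [sinc_eq_sinc_half_mul_cos, cosc_eq_sinc_half_mul_sin, Real.sin_add]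
  ring

theorem sinc_pos_of_mem_Ioo {x : ℝ} (h : x ∈ Set.Ioo (-Real.pi) Real.pi) : 0 < sinc x := by
  rcases lt_trichotomy x 0 with hx | rfl | hx
  · rw [sinc, if_neg hx.ne]
    exact div_pos_of_neg_of_neg (Real.sin_neg_of_neg_of_neg_pi_lt hx h.1) hx
  · simp [sinc]
  · rw [sinc, if_neg hx.ne']
    exact div_pos (Real.sin_pos_of_pos_of_lt_pi hx h.2) hx

/-- Two chords with directions symmetric about `α` join to a chord with direction `α` exactly when
they have the same, explicitly determined, length. -/
theorem symmetric_chords_iff {A B d α φ : ℝ} (hc : Real.cos φ ≠ 0) (hs : Real.sin φ ≠ 0) :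
    (A * Real.cos (α + φ) + B * Real.cos (α - φ) = d * Real.cos α ∧
      A * Real.sin (α + φ) + B * Real.sin (α - φ) = d * Real.sin α) ↔
    A = d / (2 * Real.cos φ) ∧ B = d / (2 * Real.cos φ) := by
  rw [Real.cos_add, Real.cos_sub, Real.sin_add, Real.sin_sub]
  have hα := Real.sin_sq_add_cos_sq α
  constructor
  · rintro ⟨h1, h2⟩
    have hsum : (A + B) * Real.cos φ = d := by
      linear_combination Real.cos α * h1 + Real.sin α * h2 + (d - (A + B) * Real.cos φ) * hα
    have hdiff : (A - B) * Real.sin φ = 0 := by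
      linear_combination Real.cos α * h2 - Real.sin α * h1 - (A - B) * Real.sin φ * hα
    have hAB : A = B := sub_eq_zero.mp ((mul_eq_zero.mp hdiff).resolve_right hs)
    subst hAB
    have hA : A = d / (2 * Real.cos φ) := by
      rw [eq_div_iff (by positivity)]
      linear_combination hsum
    exact ⟨hA, hA⟩
  · rintro ⟨rfl, rfl⟩
    constructor <;> field_simp <;> ring

theorem biarc_G1_interpolation_exists_unique
    (x0 y0 x1 y1 : ℝ) (hne : (x0, y0) ≠ (x1, y1))
    (d : ℝ) (hd : d = Real.sqrt ((x1 - x0) ^ 2 + (y1 - y0) ^ 2)) (hdpos : 0 < d)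
    (α : ℝ) (hx : x1 - x0 = d * Real.cos α) (hy : y1 - y0 = d * Real.sin α)
    (ϑ0 ϑ1 : ℝ)
    (h0 : ϑ0 - α ∈ Set.Ioo (-Real.pi) Real.pi)
    (h1 : ϑ1 - α ∈ Set.Ioo (-Real.pi) Real.pi)
    (hangles : ϑ0 ≠ ϑ1)
    (ϑs : ℝ) (hϑs : ϑs = 2 * α - (ϑ0 + ϑ1) / 2) :
    ∃! q : ℝ × ℝ × ℝ × ℝ,
      0 < q.1 ∧ 0 < q.2.1 ∧
      x0 + q.1 * (Real.cos ϑ0 * sinc (q.2.2.1 * q.1) - Real.sin ϑ0 * cosc (q.2.2.1 * q.1)) =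
        x1 - q.2.1 * (Real.cos ϑ1 * sinc (-(q.2.2.2 * q.2.1)) -
          Real.sin ϑ1 * cosc (-(q.2.2.2 * q.2.1))) ∧
      y0 + q.1 * (Real.sin ϑ0 * sinc (q.2.2.1 * q.1) + Real.cos ϑ0 * cosc (q.2.2.1 * q.1)) =
        y1 - q.2.1 * (Real.sin ϑ1 * sinc (-(q.2.2.2 * q.2.1)) +
          Real.cos ϑ1 * cosc (-(q.2.2.2 * q.2.1))) ∧
      ϑ0 + q.1 * q.2.2.1 = ϑs ∧
      ϑ1 - q.2.1 * q.2.2.2 = ϑs := by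
  obtain ⟨ha1, ha2⟩ := h0
  obtain ⟨hb1, hb2⟩ := h1
  set φ := (ϑ0 - ϑ1) / 4 with hφ
  have hc : 0 < Real.cos φ := Real.cos_pos_of_mem_Ioo ⟨by linarith, by linarith⟩
  have hs : Real.sin φ ≠ 0 := fun h ↦ by
    have := (Real.sin_eq_zero_iff_of_lt_of_lt (by linarith) (by linarith)).mp h
    exact hangles (by linarith)
  have hS0 : 0 < sinc ((ϑs - ϑ0) / 2) := sinc_pos_of_mem_Ioo ⟨by linarith, by linarith⟩
  have hS1 : 0 < sinc ((ϑs - ϑ1) / 2) := sinc_pos_of_mem_Ioo ⟨by linarith, by linarith⟩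
  have hφ0 : ϑ0 + (ϑs - ϑ0) / 2 = α + φ := by rw [hφ, hϑs]; ring
  have hφ1 : ϑ1 + (ϑs - ϑ1) / 2 = α - φ := by rw [hφ, hϑs]; ring
  have key : ∀ l0 l1 k0 k1 : ℝ, k0 * l0 = ϑs - ϑ0 → -(k1 * l1) = ϑs - ϑ1 →
      ((x0 + l0 * (Real.cos ϑ0 * sinc (k0 * l0) - Real.sin ϑ0 * cosc (k0 * l0)) =
          x1 - l1 * (Real.cos ϑ1 * sinc (-(k1 * l1)) - Real.sin ϑ1 * cosc (-(k1 * l1))) ∧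
        y0 + l0 * (Real.sin ϑ0 * sinc (k0 * l0) + Real.cos ϑ0 * cosc (k0 * l0)) =
          y1 - l1 * (Real.sin ϑ1 * sinc (-(k1 * l1)) + Real.cos ϑ1 * cosc (-(k1 * l1)))) ↔
      l0 * sinc ((ϑs - ϑ0) / 2) = d / (2 * Real.cos φ) ∧
        l1 * sinc ((ϑs - ϑ1) / 2) = d / (2 * Real.cos φ)) := by
    intro l0 l1 k0 k1 e0 e1
    rw [e0, e1, arc_chord_fst, arc_chord_fst, arc_chord_snd, arc_chord_snd, hφ0, hφ1,
      ← symmetric_chords_iff (α := α) hc.ne' hs, ← hx, ← hy]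
    constructor <;> rintro ⟨h, h'⟩ <;> constructor <;> linarith
  set D := d / (2 * Real.cos φ) with hD
  have hDpos : 0 < D := by positivity
  have hl0 : 0 < D / sinc ((ϑs - ϑ0) / 2) := by positivity
  have hl1 : 0 < D / sinc ((ϑs - ϑ1) / 2) := by positivity
  refine ⟨(D / sinc ((ϑs - ϑ0) / 2), D / sinc ((ϑs - ϑ1) / 2),
    (ϑs - ϑ0) / (D / sinc ((ϑs - ϑ0) / 2)), (ϑ1 - ϑs) / (D / sinc ((ϑs - ϑ1) / 2))), ?_, ?_⟩
  · have e0 := div_mul_cancel₀ (ϑs - ϑ0) hl0.ne'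
    have e1 := div_mul_cancel₀ (ϑ1 - ϑs) hl1.ne'
    obtain ⟨hfst, hsnd⟩ := (key _ _ _ _ e0 (by rw [e1]; ring)).mpr
      ⟨div_mul_cancel₀ D hS0.ne', div_mul_cancel₀ D hS1.ne'⟩
    exact ⟨hl0, hl1, hfst, hsnd, by linarith, by linarith⟩
  · rintro ⟨l0, l1, k0, k1⟩ ⟨hp0, hp1, hfst, hsnd, e0, e1⟩
    dsimp only at hp0 hp1 hfst hsnd e0 e1
    obtain ⟨h0, h1⟩ := (key l0 l1 k0 k1 (by linarith) (by linarith)).mp ⟨hfst, hsnd⟩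
    rw [← eq_div_iff hS0.ne'] at h0
    rw [← eq_div_iff hS1.ne'] at h1
    rw [← h0, ← h1]
    refine Prod.ext rfl (Prod.ext rfl (Prod.ext ?_ ?_))
    · exact (eq_div_iff hp0.ne').mpr (by linarith)
    · exact (eq_div_iff hp1.ne').mpr (by linarith)
end
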